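/- Let k ≥ 5, let v ≥ k, and let v_{1,1}, v_{1,2}, v_{2,1}, v_{2,2} be nonnegative integers with Σ_{i=1}^{2} Σ_{j=1}^{2} v_{i,j} = v−1, such that each of the sums v_{1,1}+v_{2,1}, v_{1,2}+v_{2,2}, v_{1,1}+v_{2,2}, v_{1,2}+v_{2,1} is at least k−3 and each of v_{1,1}+v_{1,2}, v_{2,1}+v_{2,2} is at least k−2. Then C(v+3, k, 4, 5) ≤ 3·⌊k·C(v,k,4,5)/v⌋ + C(v,k,4,5) + C(v_{1,1}+v_{2,1}, k−3, 2) + C(v_{1,2}+v_{2,2}, k−3, 2) + C(v_{1,1}+v_{2,2}, k−3, 2) + C(v_{1,2}+v_{2,1}, k−3, 2) + C(v_{1,1}+v_{1,2}, k−2, 2) + C(v_{2,1}+v_{2,2}, k−2, 2). -/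

import Mathlib

/-- `(X, Bs)` is a `(|X|, k, t, m)` cover: `Bs` is a collection of `k`-subsets of `X` such that
every `m`-subset of `X` intersects at least one block of `Bs` in at least `t` points. -/
def IsCover {α : Type*} [DecidableEq α] (X : Finset α) (Bs : Finset (Finset α))
    (k t m : ℕ) : Prop :=
  (∀ B ∈ Bs, B ⊆ X ∧ B.card = k) ∧
  ∀ M ⊆ X, M.card = m → ∃ B ∈ Bs, t ≤ (M ∩ B).card

/-- The cover number `C(v,k,t,m)`: the minimum number of blocks of a `(v,k,t,m)` cover.
The covering number `C(v,k,t)` is `C(v,k,t,t)`. -/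
noncomputable def coverNumber (v k t m : ℕ) : ℕ :=
  sInf { b | ∃ Bs : Finset (Finset (Fin v)),
    IsCover Finset.univ Bs k t m ∧ Bs.card = b }

theorem IsCover.map {α β : Type*} [DecidableEq α] [DecidableEq β] {X : Finset α}
    {Bs : Finset (Finset α)} {k t m : ℕ} (h : IsCover X Bs k t m) (f : α ↪ β) :
    IsCover (X.map f) (Bs.map (Finset.mapEmbedding f).toEmbedding) k t m := by
  refine ⟨fun B hB => ?_, fun M hM hcard => ?_⟩
  · obtain ⟨B', hB', rfl⟩ := Finset.mem_map.1 hB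
    obtain ⟨hsub, hc⟩ := h.1 B' hB'
    exact ⟨Finset.map_subset_map.2 hsub, (Finset.card_map f).trans hc⟩
  · obtain ⟨M', hM', rfl⟩ := Finset.subset_map_iff.1 hM
    rw [Finset.card_map] at hcard
    obtain ⟨B, hB, hle⟩ := h.2 M' hM' hcard
    refine ⟨B.map f, Finset.mem_map.2 ⟨B, hB, rfl⟩, ?_⟩
    rwa [← Finset.map_inter, Finset.card_map]

theorem coverNumber_le_card {α : Type*} [DecidableEq α] {X : Finset α}
    {Bs : Finset (Finset α)} {k t m : ℕ} (h : IsCover X Bs k t m) :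
    coverNumber X.card k t m ≤ Bs.card := by
  classical
  refine Nat.sInf_le ?_
  let e : X ≃ Fin X.card := X.equivFin
  refine ⟨Bs.image fun B => Finset.univ.filter fun i => ((e.symm i : X) : α) ∈ B,
    ⟨?_, ?_⟩, ?_⟩
  · intro C hC
    obtain ⟨B, hB, rfl⟩ := Finset.mem_image.1 hC
    obtain ⟨hsub, hc⟩ := h.1 B hB
    refine ⟨Finset.subset_univ _, ?_⟩
    rw [← hc]
    refine Finset.card_bij (fun i _ => ((e.symm i : X) : α)) ?_ ?_ ?_
    · intro i hi
      simpa using hi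
    · intro i _ j _ hij
      exact e.symm.injective (Subtype.ext hij)
    · intro b hb
      exact ⟨e ⟨b, hsub hb⟩, by simpa using hb, by simp⟩
  · intro M _ hM
    let g : Fin X.card ↪ α := e.symm.toEmbedding.trans (Function.Embedding.subtype _)
    obtain ⟨B, hB, hle⟩ := h.2 (M.map g)
      (by
        intro y hy
        obtain ⟨i, _, rfl⟩ := Finset.mem_map.1 hy
        exact (e.symm i).2)
      (by rw [Finset.card_map, hM])
    refine ⟨_, Finset.mem_image_of_mem _ hB, hle.trans ?_⟩
    rw [← Finset.card_map g]
    refine Finset.card_le_card fun y hy => ?_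
    obtain ⟨hy, hyB⟩ := Finset.mem_inter.1 hy
    obtain ⟨i, hi, rfl⟩ := Finset.mem_map.1 hy
    exact Finset.mem_map_of_mem _ (Finset.mem_inter.2 ⟨hi, by simpa [g] using hyB⟩)
  · refine Finset.card_image_of_injOn fun B hB C hC hBC => ?_
    ext y
    by_cases hy : y ∈ X
    · have := Finset.ext_iff.1 hBC (e ⟨y, hy⟩)
      simpa using this
    · exact ⟨fun h' => absurd ((h.1 B hB).1 h') hy, fun h' => absurd ((h.1 C hC).1 h') hy⟩

theorem isCover_powersetCard {α : Type*} [DecidableEq α] {X : Finset α} {k t m : ℕ}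
    (htk : t ≤ k) (htm : t ≤ m) (hk : k ≤ X.card) :
    IsCover X (X.powersetCard k) k t m := by
  refine ⟨fun B hB => Finset.mem_powersetCard.1 hB, fun M hM hcard => ?_⟩
  obtain ⟨S, hSM, hS⟩ := Finset.exists_subset_card_eq (htm.trans hcard.ge)
  obtain ⟨B, hSB, hBX, hB⟩ :=
    Finset.exists_subsuperset_card_eq (hSM.trans hM) (hS.trans_le htk) hk
  exact ⟨B, Finset.mem_powersetCard.2 ⟨hBX, hB⟩,
    hS.ge.trans (Finset.card_le_card (Finset.subset_inter hSM hSB))⟩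

theorem exists_isCover_card_eq_coverNumber {α : Type*} [DecidableEq α] {X : Finset α}
    {k t m : ℕ} (htk : t ≤ k) (htm : t ≤ m) (hk : k ≤ X.card) :
    ∃ Bs, IsCover X Bs k t m ∧ Bs.card = coverNumber X.card k t m := by
  obtain ⟨Bs, hBs, hcard⟩ : coverNumber X.card k t m ∈ { b | ∃ Bs : Finset (Finset (Fin X.card)),
      IsCover Finset.univ Bs k t m ∧ Bs.card = b } :=
    Nat.sInf_mem ⟨_, _, isCover_powersetCard htk htm (by simpa using hk), rfl⟩
  let g : Fin X.card ↪ α := X.equivFin.symm.toEmbedding.trans (Function.Embedding.subtype _)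
  have hg : Finset.univ.map g = X := by
    ext y
    simp only [Finset.mem_map, Finset.mem_univ, true_and]
    exact ⟨fun ⟨i, hi⟩ => hi ▸ (X.equivFin.symm i).2,
      fun hy => ⟨X.equivFin ⟨y, hy⟩, by simp [g]⟩⟩
  exact ⟨_, hg ▸ hBs.map g, (Finset.card_map _).trans hcard⟩

theorem IsCover.exists_mem_mem {α : Type*} [DecidableEq α] {X : Finset α}
    {Bs : Finset (Finset α)} {k : ℕ} (h : IsCover X Bs k 2 2) (hX : 2 ≤ X.card)
    {p q : α} (hp : p ∈ X) (hq : q ∈ X) : ∃ B ∈ Bs, p ∈ B ∧ q ∈ B := by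
  obtain ⟨M, hM, hMX, hcard⟩ := Finset.exists_subsuperset_card_eq
    (Finset.insert_subset hp (Finset.singleton_subset_iff.2 hq)) Finset.card_le_two hX
  obtain ⟨B, hB, hle⟩ := h.2 M hMX hcard
  have hMB : M ⊆ B := by
    rw [← Finset.inter_eq_left]
    exact Finset.eq_of_subset_of_card_le Finset.inter_subset_left (hcard.trans_le hle)
  exact ⟨B, hB, hMB (hM (by simp)), hMB (hM (by simp))⟩

/-- Adjoining a fixed set `T` of new points to every block of an optimal pair covering of `P`. -/
theorem exists_disjSum_pair_cover {α ι : Type*} [DecidableEq α] [Fintype ι] [DecidableEq ι]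
    {Y P : Finset α} (hPY : P ⊆ Y) (T : Finset ι) {k : ℕ} (hk : 2 ≤ k) (hP : k ≤ P.card) :
    ∃ Cs : Finset (Finset (α ⊕ ι)), Cs.card ≤ coverNumber P.card k 2 2 ∧
      (∀ C ∈ Cs, C ⊆ Y.disjSum Finset.univ ∧ C.card = k + T.card) ∧
      ∀ p ∈ P, ∀ q ∈ P, ∃ S : Finset α, S.disjSum T ∈ Cs ∧ p ∈ S ∧ q ∈ S := by
  obtain ⟨Bs, hBs, hcard⟩ :=
    exists_isCover_card_eq_coverNumber (X := P) hk (le_refl 2) hP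
  refine ⟨Bs.image (·.disjSum T), Finset.card_image_le.trans hcard.le, ?_, ?_⟩
  · intro C hC
    obtain ⟨B, hB, rfl⟩ := Finset.mem_image.1 hC
    obtain ⟨hsub, hc⟩ := hBs.1 B hB
    exact ⟨Finset.disjSum_mono (hsub.trans hPY) (Finset.subset_univ _), by
      rw [Finset.card_disjSum, hc]⟩
  · intro p hp q hq
    obtain ⟨B, hB, h⟩ := hBs.exists_mem_mem (hk.trans hP) hp hq
    exact ⟨B, Finset.mem_image_of_mem _ hB, h⟩

theorem card_inter_disjSum {α ι : Type*} [DecidableEq α] [DecidableEq ι]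
    (M : Finset (α ⊕ ι)) (S : Finset α) (T : Finset ι) :
    (M ∩ S.disjSum T).card = (M.toLeft ∩ S).card + (M.toRight ∩ T).card := by
  rw [← Finset.card_toLeft_add_card_toRight, Finset.toLeft_inter, Finset.toRight_inter,
    Finset.toLeft_disjSum, Finset.toRight_disjSum]

theorem IsCover.exists_degree_le {α : Type*} [DecidableEq α] {X : Finset α}
    {Bs : Finset (Finset α)} {k t m : ℕ} (h : IsCover X Bs k t m) (hX : X.Nonempty) :
    ∃ x ∈ X, (Bs.filter (x ∈ ·)).card ≤ k * Bs.card / X.card := by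
  obtain ⟨x, hx, hmin⟩ := Finset.exists_min_image X (fun x => (Bs.filter (x ∈ ·)).card) hX
  refine ⟨x, hx, (Nat.le_div_iff_mul_le hX.card_pos).2 ?_⟩
  have hsum : ∑ y ∈ X, (Bs.filter (y ∈ ·)).card = ∑ B ∈ Bs, (X.filter (· ∈ B)).card :=
    Finset.sum_card_bipartiteAbove_eq_sum_card_bipartiteBelow (fun y B => y ∈ B)
  have hk : ∑ B ∈ Bs, (X.filter (· ∈ B)).card = Bs.card * k := by
    refine Finset.sum_const_nat fun B hB => ?_
    rw [Finset.filter_mem_eq_inter, Finset.inter_eq_right.2 (h.1 B hB).1, (h.1 B hB).2]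
  have := Finset.card_nsmul_le_sum X _ _ hmin
  rw [smul_eq_mul] at this
  linarith [mul_comm k Bs.card, mul_comm X.card (Bs.filter (x ∈ ·)).card]

/-- Splicing the point `x` into the points of `ι`: the blocks obtained from those of `Bs` by
replacing `x` with each point of `ι` in turn cover every `m`-set containing at most one point
of `ι`. -/
theorem IsCover.exists_splice {α ι : Type*} [DecidableEq α] [Fintype ι] [DecidableEq ι]
    [Nonempty ι] {X : Finset α} {Bs : Finset (Finset α)} {k t m : ℕ} (h : IsCover X Bs k t m)
    {x : α} (hx : x ∈ X) :
    ∃ Cs : Finset (Finset (α ⊕ ι)),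
      Cs.card + (Bs.filter (x ∈ ·)).card ≤
        Bs.card + Fintype.card ι * (Bs.filter (x ∈ ·)).card ∧
      (∀ C ∈ Cs, C ⊆ (X.erase x).disjSum Finset.univ ∧ C.card = k) ∧
      ∀ M ⊆ (X.erase x).disjSum (Finset.univ : Finset ι), M.card = m → M.toRight.card ≤ 1 →
        ∃ C ∈ Cs, t ≤ (M ∩ C).card := by
  refine ⟨(Bs.filter (x ∉ ·)).image (·.disjSum ∅) ∪
    ((Finset.univ : Finset ι) ×ˢ Bs.filter (x ∈ ·)).image
      (fun a => (a.2.erase x).disjSum {a.1}), ?_, ?_, ?_⟩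
  · have h1 := Finset.card_union_le ((Bs.filter (x ∉ ·)).image (·.disjSum (∅ : Finset ι)))
      (((Finset.univ : Finset ι) ×ˢ Bs.filter (x ∈ ·)).image
        (fun a => (a.2.erase x).disjSum {a.1}))
    have h2 := Finset.card_image_le (s := Bs.filter (x ∉ ·))
      (f := (·.disjSum (∅ : Finset ι)))
    have h3 := Finset.card_image_le (s := (Finset.univ : Finset ι) ×ˢ Bs.filter (x ∈ ·))
      (f := fun a => (a.2.erase x).disjSum {a.1})
    rw [Finset.card_product, Finset.card_univ] at h3
    have h4 := Finset.card_filter_add_card_filter_not (s := Bs) (x ∈ ·)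
    omega
  · intro C hC
    rcases Finset.mem_union.1 hC with hC | hC
    · obtain ⟨B, hB, rfl⟩ := Finset.mem_image.1 hC
      obtain ⟨hB, hxB⟩ := Finset.mem_filter.1 hB
      obtain ⟨hsub, hc⟩ := h.1 B hB
      exact ⟨Finset.disjSum_mono (Finset.subset_erase.2 ⟨hsub, hxB⟩) (Finset.subset_univ _),
        by simp [hc]⟩
    · obtain ⟨⟨i, B⟩, hB, rfl⟩ := Finset.mem_image.1 hC
      obtain ⟨hB, hxB⟩ := Finset.mem_filter.1 (Finset.mem_product.1 hB).2
      obtain ⟨hsub, hc⟩ := h.1 B hB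
      refine ⟨Finset.disjSum_mono (Finset.erase_subset_erase _ hsub) (Finset.subset_univ _), ?_⟩
      rw [Finset.card_disjSum, Finset.card_singleton, Finset.card_erase_add_one hxB, hc]
  · intro M hM hcard hR
    have hL : M.toLeft ⊆ X.erase x := fun y hy => by
      simpa using hM (Finset.mem_toLeft.1 hy)
    have hxL : x ∉ M.toLeft := fun hxL => by simpa using hL hxL
    have hLR := Finset.card_toLeft_add_card_toRight (u := M)
    suffices ∃ B ∈ Bs, ∃ i, t ≤ (M.toLeft ∩ B.erase x).card +
        if x ∈ B then (M.toRight ∩ {i}).card else 0 by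
      obtain ⟨B, hB, i, hle⟩ := this
      by_cases hxB : x ∈ B
      · rw [if_pos hxB] at hle
        refine ⟨(B.erase x).disjSum {i}, Finset.mem_union_right _ (Finset.mem_image.2
          ⟨(i, B), Finset.mem_product.2 ⟨Finset.mem_univ _, Finset.mem_filter.2 ⟨hB, hxB⟩⟩,
            rfl⟩), ?_⟩
        rwa [card_inter_disjSum]
      · rw [if_neg hxB, Finset.erase_eq_of_notMem hxB] at hle
        refine ⟨B.disjSum ∅, Finset.mem_union_left _ (Finset.mem_image_of_mem _
          (Finset.mem_filter.2 ⟨hB, hxB⟩)), ?_⟩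
        rwa [card_inter_disjSum, Finset.inter_empty, Finset.card_empty]
    have herase : ∀ B : Finset α, M.toLeft ∩ B.erase x = M.toLeft ∩ B := fun B => by
      rw [Finset.inter_erase, Finset.erase_eq_of_notMem fun h' => hxL (Finset.mem_inter.1 h').1]
    rcases Nat.le_one_iff_eq_zero_or_eq_one.1 hR with hR | hR
    · obtain ⟨B, hB, hle⟩ := h.2 M.toLeft (hL.trans (Finset.erase_subset _ _)) (by omega)
      exact ⟨B, hB, Classical.arbitrary ι, by rw [herase]; omega⟩
    · obtain ⟨i, hi⟩ := Finset.card_eq_one.1 hR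
      obtain ⟨B, hB, hle⟩ := h.2 (insert x M.toLeft)
        (Finset.insert_subset hx (hL.trans (Finset.erase_subset _ _)))
        (by rw [Finset.card_insert_of_notMem hxL]; omega)
      refine ⟨B, hB, i, hle.trans ?_⟩
      rw [herase, hi, Finset.inter_self, Finset.card_singleton]
      split_ifs with hxB
      · rw [Finset.insert_inter_of_mem hxB]
        exact Finset.card_insert_le _ _
      · rw [Finset.insert_inter_of_notMem hxB, add_zero]

theorem exists_four_cells {α : Type*} [DecidableEq α] {Y : Finset α} {a b c d : ℕ}
    (h : Y.card = a + b + c + d) :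
    ∃ A B C D : Finset α, A.card = a ∧ B.card = b ∧ C.card = c ∧ D.card = d ∧
      Disjoint A B ∧ Disjoint A C ∧ Disjoint A D ∧ Disjoint B C ∧ Disjoint B D ∧
      Disjoint C D ∧ A ∪ B ∪ C ∪ D = Y := by
  obtain ⟨A, hAY, hA⟩ := Finset.exists_subset_card_eq (s := Y) (n := a) (by omega)
  have hYA := Finset.card_sdiff_add_card_eq_card hAY
  obtain ⟨B, hBY, hB⟩ := Finset.exists_subset_card_eq (s := Y \ A) (n := b) (by omega)
  have hYB := Finset.card_sdiff_add_card_eq_card hBY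
  obtain ⟨C, hCY, hC⟩ := Finset.exists_subset_card_eq (s := (Y \ A) \ B) (n := c) (by omega)
  have hYC := Finset.card_sdiff_add_card_eq_card hCY
  refine ⟨A, B, C, ((Y \ A) \ B) \ C, hA, hB, hC, by omega, ?_⟩
  simp only [Finset.disjoint_left, Finset.subset_iff, Finset.mem_sdiff, Finset.ext_iff,
    Finset.mem_union] at *
  grind

/-- Suppose the blocks `S ⊔ T` of `Cs` handle pairs of points of `Y` for `T` one of `{0, 1, 2}`,
`{0, 1, 3}`, `{2, 3}`. Then `Cs` covers all `5`-sets with at least two points in `Fin 4`. -/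
theorem exists_four_le_card_inter {α : Type*} [DecidableEq α] {Y : Finset α}
    {Cs : Finset (Finset (α ⊕ Fin 4))} {G : Finset (Fin 4) → α → α → Prop}
    (hG : ∀ T p q, G T p q → ∃ S : Finset α, S.disjSum T ∈ Cs ∧ p ∈ S ∧ q ∈ S)
    (hpoint : ∀ p ∈ Y, G {0, 1, 2} p p)
    (hpoint' : ∀ p ∈ Y, G {0, 1, 3} p p)
    (hpair : ∀ p ∈ Y, ∀ q ∈ Y, G {0, 1, 2} p q ∨ G {0, 1, 3} p q ∨ G {2, 3} p q)
    (htriple : ∀ T ∈ ({{0, 1, 2}, {0, 1, 3}, {2, 3}} : Finset (Finset (Fin 4))),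
      ∀ p ∈ Y, ∀ q ∈ Y, ∀ r ∈ Y, G T p q ∨ G T p r ∨ G T q r)
    {M : Finset (α ⊕ Fin 4)} (hM : M ⊆ Y.disjSum Finset.univ) (hcard : M.card = 5)
    (hR : 2 ≤ M.toRight.card) : ∃ C ∈ Cs, 4 ≤ (M ∩ C).card := by
  have hL : M.toLeft ⊆ Y := fun y hy => by simpa using hM (Finset.mem_toLeft.1 hy)
  have hLR := Finset.card_toLeft_add_card_toRight (u := M)
  have hR4 : M.toRight.card ≤ 4 := Finset.card_le_univ _
  have one : ∀ T p, p ∈ M.toLeft → G T p p → 3 ≤ (M.toRight ∩ T).card →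
      ∃ C ∈ Cs, 4 ≤ (M ∩ C).card := by
    intro T p hp hg hT
    obtain ⟨S, hS, hpS, -⟩ := hG T p p hg
    refine ⟨_, hS, ?_⟩
    have : 0 < (M.toLeft ∩ S).card := Finset.card_pos.2 ⟨p, Finset.mem_inter.2 ⟨hp, hpS⟩⟩
    rw [card_inter_disjSum]
    omega
  have two : ∀ T p q, p ∈ M.toLeft → q ∈ M.toLeft → p ≠ q → G T p q →
      2 ≤ (M.toRight ∩ T).card → ∃ C ∈ Cs, 4 ≤ (M ∩ C).card := by
    intro T p q hp hq hpq hg hT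
    obtain ⟨S, hS, hpS, hqS⟩ := hG T p q hg
    refine ⟨_, hS, ?_⟩
    have : 1 < (M.toLeft ∩ S).card := Finset.one_lt_card.2
      ⟨p, Finset.mem_inter.2 ⟨hp, hpS⟩, q, Finset.mem_inter.2 ⟨hq, hqS⟩, hpq⟩
    rw [card_inter_disjSum]
    omega
  have h2 : ∀ R : Finset (Fin 4), R.card = 2 →
      ∃ T ∈ ({{0, 1, 2}, {0, 1, 3}, {2, 3}} : Finset (Finset (Fin 4))),
        2 ≤ (R ∩ T).card := by decide
  have h3 : ∀ R : Finset (Fin 4), R.card = 3 →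
      3 ≤ (R ∩ {0, 1, 2}).card ∨ 3 ≤ (R ∩ {0, 1, 3}).card ∨
        2 ≤ (R ∩ {0, 1, 2}).card ∧ 2 ≤ (R ∩ {0, 1, 3}).card ∧ 2 ≤ (R ∩ {2, 3}).card := by
    decide
  have h4 : ∀ R : Finset (Fin 4), R.card = 4 → 3 ≤ (R ∩ {0, 1, 2}).card := by decide
  obtain h | h | h : M.toRight.card = 2 ∨ M.toRight.card = 3 ∨ M.toRight.card = 4 := by omega
  · obtain ⟨T, hT, hRT⟩ := h2 _ h
    obtain ⟨p, q, r, hp, hq, hr, hpq, hpr, hqr⟩ := Finset.two_lt_card_iff.1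
      (show 2 < M.toLeft.card by omega)
    rcases htriple T hT p (hL hp) q (hL hq) r (hL hr) with hg | hg | hg
    · exact two T p q hp hq hpq hg hRT
    · exact two T p r hp hr hpr hg hRT
    · exact two T q r hq hr hqr hg hRT
  · obtain ⟨p, hp, q, hq, hpq⟩ := Finset.one_lt_card.1 (show 1 < M.toLeft.card by omega)
    rcases h3 _ h with hT | hT | ⟨hT₁, hT₂, hT₃⟩
    · exact one _ p hp (hpoint p (hL hp)) hT
    · exact one _ p hp (hpoint' p (hL hp)) hT
    · rcases hpair p (hL hp) q (hL hq) with hg | hg | hg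
      · exact two _ p q hp hq hpq hg hT₁
      · exact two _ p q hp hq hpq hg hT₂
      · exact two _ p q hp hq hpq hg hT₃
  · obtain ⟨p, hp⟩ := Finset.card_pos.1 (show 0 < M.toLeft.card by omega)
    exact one _ p hp (hpoint p (hL hp)) (h4 _ h)

/-- Upper bound arising from the point splicing construction for `(v,k,4,5)` covers:
`C(v+3,k,4,5) ≤ 3⌊kC(v,k,4,5)/v⌋ + C(v,k,4,5) + (sum of pairwise `(·, k-3, 2)` and
`(·, k-2, 2)` covering numbers over the parts)`. Here `C(u,k',2) = coverNumber u k' 2 2`. -/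
theorem splicing_bound_445 (v k v11 v12 v21 v22 : ℕ)
    (hk : 5 ≤ k) (hv : k ≤ v)
    (hsum : v11 + v12 + v21 + v22 = v - 1)
    (h1 : k - 3 ≤ v11 + v21) (h2 : k - 3 ≤ v12 + v22)
    (h3 : k - 3 ≤ v11 + v22) (h4 : k - 3 ≤ v12 + v21)
    (h6 : k - 2 ≤ v11 + v12) (h7 : k - 2 ≤ v21 + v22) :
    coverNumber (v + 3) k 4 5 ≤
      3 * (k * coverNumber v k 4 5 / v) + coverNumber v k 4 5 +
        coverNumber (v11 + v21) (k - 3) 2 2 + coverNumber (v12 + v22) (k - 3) 2 2 +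
        coverNumber (v11 + v22) (k - 3) 2 2 + coverNumber (v12 + v21) (k - 3) 2 2 +
        coverNumber (v11 + v12) (k - 2) 2 2 + coverNumber (v21 + v22) (k - 2) 2 2 := by
  obtain ⟨Bs, hBs, hBcard⟩ := exists_isCover_card_eq_coverNumber
    (X := (Finset.univ : Finset (Fin v))) (k := k) (t := 4) (m := 5) (by omega) (by omega)
    (by simpa using hv)
  obtain ⟨x, hx, hdeg⟩ := hBs.exists_degree_le ⟨⟨0, by omega⟩, Finset.mem_univ _⟩
  rw [hBcard, Finset.card_univ, Fintype.card_fin] at hdeg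
  rw [Finset.card_univ, Fintype.card_fin] at hBcard
  obtain ⟨Cs, hCcard, hCs, hCcov⟩ := hBs.exists_splice (ι := Fin 4) hx
  rw [Fintype.card_fin] at hCcard
  have hYcard : (Finset.univ.erase x).card = v11 + v12 + v21 + v22 := by
    rw [Finset.card_erase_of_mem hx, Finset.card_univ, Fintype.card_fin, hsum]
  generalize Finset.univ.erase x = Y at *
  obtain ⟨A, B, C, D, rfl, rfl, rfl, rfl, hAB, hAC, hAD, hBC, hBD, hCD, rfl⟩ :=
    exists_four_cells hYcard
  have cAC := Finset.card_union_of_disjoint hAC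
  have cBD := Finset.card_union_of_disjoint hBD
  have cAD := Finset.card_union_of_disjoint hAD
  have cBC := Finset.card_union_of_disjoint hBC
  have cAB := Finset.card_union_of_disjoint hAB
  have cCD := Finset.card_union_of_disjoint hCD
  set Y := A ∪ B ∪ C ∪ D with hY
  obtain ⟨DAC, nAC, bAC, pAC⟩ := exists_disjSum_pair_cover (Y := Y) (P := A ∪ C)
    (by grind) ({0, 1, 2} : Finset (Fin 4)) (k := k - 3) (by omega) (by omega)
  obtain ⟨DBD, nBD, bBD, pBD⟩ := exists_disjSum_pair_cover (Y := Y) (P := B ∪ D)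
    (by grind) ({0, 1, 2} : Finset (Fin 4)) (k := k - 3) (by omega) (by omega)
  obtain ⟨DAD, nAD, bAD, pAD⟩ := exists_disjSum_pair_cover (Y := Y) (P := A ∪ D)
    (by grind) ({0, 1, 3} : Finset (Fin 4)) (k := k - 3) (by omega) (by omega)
  obtain ⟨DBC, nBC, bBC, pBC⟩ := exists_disjSum_pair_cover (Y := Y) (P := B ∪ C)
    (by grind) ({0, 1, 3} : Finset (Fin 4)) (k := k - 3) (by omega) (by omega)
  obtain ⟨DAB, nAB, bAB, pAB⟩ := exists_disjSum_pair_cover (Y := Y) (P := A ∪ B)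
    (by grind) ({2, 3} : Finset (Fin 4)) (k := k - 2) (by omega) (by omega)
  obtain ⟨DCD, nCD, bCD, pCD⟩ := exists_disjSum_pair_cover (Y := Y) (P := C ∪ D)
    (by grind) ({2, 3} : Finset (Fin 4)) (k := k - 2) (by omega) (by omega)
  rw [cAC] at nAC
  rw [cBD] at nBD
  rw [cAD] at nAD
  rw [cBC] at nBC
  rw [cAB] at nAB
  rw [cCD] at nCD
  let Ps := DAC ∪ DBD ∪ DAD ∪ DBC ∪ DAB ∪ DCD
  let G : Finset (Fin 4) → Fin v → Fin v → Prop :=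
    fun T p q => ∃ S : Finset (Fin v), S.disjSum T ∈ Ps ∧ p ∈ S ∧ q ∈ S
  have gAC : ∀ p ∈ A ∪ C, ∀ q ∈ A ∪ C, G {0, 1, 2} p q := fun p hp q hq =>
    (pAC p hp q hq).imp fun S hS => ⟨by simp [Ps, hS.1], hS.2⟩
  have gBD : ∀ p ∈ B ∪ D, ∀ q ∈ B ∪ D, G {0, 1, 2} p q := fun p hp q hq =>
    (pBD p hp q hq).imp fun S hS => ⟨by simp [Ps, hS.1], hS.2⟩
  have gAD : ∀ p ∈ A ∪ D, ∀ q ∈ A ∪ D, G {0, 1, 3} p q := fun p hp q hq =>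
    (pAD p hp q hq).imp fun S hS => ⟨by simp [Ps, hS.1], hS.2⟩
  have gBC : ∀ p ∈ B ∪ C, ∀ q ∈ B ∪ C, G {0, 1, 3} p q := fun p hp q hq =>
    (pBC p hp q hq).imp fun S hS => ⟨by simp [Ps, hS.1], hS.2⟩
  have gAB : ∀ p ∈ A ∪ B, ∀ q ∈ A ∪ B, G {2, 3} p q := fun p hp q hq =>
    (pAB p hp q hq).imp fun S hS => ⟨by simp [Ps, hS.1], hS.2⟩
  have gCD : ∀ p ∈ C ∪ D, ∀ q ∈ C ∪ D, G {2, 3} p q := fun p hp q hq =>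
    (pCD p hp q hq).imp fun S hS => ⟨by simp [Ps, hS.1], hS.2⟩
  have hcov : IsCover (Y.disjSum (Finset.univ : Finset (Fin 4))) (Cs ∪ Ps) k 4 5 := by
    refine ⟨fun E hE => ?_, fun M hM hcard => ?_⟩
    · have t₁ : ({0, 1, 2} : Finset (Fin 4)).card = 3 := rfl
      have t₂ : ({0, 1, 3} : Finset (Fin 4)).card = 3 := rfl
      have t₃ : ({2, 3} : Finset (Fin 4)).card = 2 := rfl
      have e₃ : k - 3 + 3 = k := by omega
      have e₂ : k - 2 + 2 = k := by omega
      rw [t₁, e₃] at bAC bBD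
      rw [t₂, e₃] at bAD bBC
      rw [t₃, e₂] at bAB bCD
      simp only [Ps, Finset.mem_union] at hE
      rcases hE with hE | ((((hE | hE) | hE) | hE) | hE) | hE
      exacts [hCs E hE, bAC E hE, bBD E hE, bAD E hE, bBC E hE, bAB E hE, bCD E hE]
    · rcases Nat.lt_or_ge 1 M.toRight.card with hR | hR
      · refine (exists_four_le_card_inter (Y := Y) (Cs := Ps) (G := G)
          (fun T p q h => h) ?_ ?_ ?_ ?_ hM hcard hR).imp
          fun E hE => ⟨Finset.mem_union_right _ hE.1, hE.2⟩
        · clear_value G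
          grind
        · clear_value G
          grind
        · clear_value G
          grind
        · intro T hT
          simp only [Finset.mem_insert, Finset.mem_singleton] at hT
          clear_value G
          rcases hT with rfl | rfl | rfl <;> grind
      · obtain ⟨E, hE, hle⟩ := hCcov M hM hcard hR
        exact ⟨E, Finset.mem_union_left _ hE, hle⟩
  have hle := coverNumber_le_card hcov
  rw [Finset.card_disjSum, hYcard, hsum, Finset.card_univ, Fintype.card_fin,
    show v - 1 + 4 = v + 3 by omega] at hle
  have u₀ := Finset.card_union_le Cs Ps
  have u₁ := Finset.card_union_le (DAC ∪ DBD ∪ DAD ∪ DBC ∪ DAB) DCD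
  have u₂ := Finset.card_union_le (DAC ∪ DBD ∪ DAD ∪ DBC) DAB
  have u₃ := Finset.card_union_le (DAC ∪ DBD ∪ DAD) DBC
  have u₄ := Finset.card_union_le (DAC ∪ DBD) DAD
  have u₅ := Finset.card_union_le DAC DBD
  simp only [Ps] at hle u₀
  omega
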